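/- Let f_1, …, f_T : ℝ^d → ℝ be differentiable functions, each convex on K and α-smooth on K, and for each t let x_t⋆ ∈ K be a minimizer of f_t over K. Let x_1 ∈ K and, for each t = 1, …, T−1, let x_{t+1} ∈ K be a Euclidean projection onto K of x_t − (1/α)∇f_t(x_t), i.e., ‖x_{t+1} − (x_t − (1/α)∇f_t(x_t))‖ ≤ ‖u − (x_t − (1/α)∇f_t(x_t))‖ for all u ∈ K (online gradient descent with step size 1/α). Let M satisfy 2|f_t(u)| ≤ M for all t and all u ∈ K, let δ_2, …, δ_T be reals with |f_t(u) − f_{t−1}(u)| ≤ δ_t for all u ∈ K, and set V_T = Σ_{t=2}^T δ_t. Then Σ_{t=1}^T f_t(x_t) − Σ_{t=1}^T f_t(x_t⋆) ≤ M + V_T + √(2αD²(T−1)(M + V_T)). -/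

import Mathlib

open RealInnerProductSpace Finset

/-- First-order lower bound for a function convex on a set: it lies above its tangent planes. -/
theorem ConvexOn.add_inner_gradient_le {E : Type*} [NormedAddCommGroup E] [InnerProductSpace ℝ E]
    [CompleteSpace E] {K : Set E} {f : E → ℝ} (hf : ConvexOn ℝ K f) {x y : E} (hx : x ∈ K)
    (hy : y ∈ K) (hd : DifferentiableAt ℝ f x) :
    f x + ⟪gradient f x, y - x⟫ ≤ f y := by
  have hconv : ConvexOn ℝ (AffineMap.lineMap x y ⁻¹' K) (f ∘ AffineMap.lineMap (k := ℝ) x y) :=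
    hf.comp_affineMap _
  have hderiv : HasDerivAt (f ∘ AffineMap.lineMap (k := ℝ) x y) ⟪gradient f x, y - x⟫ 0 := by
    have hgrad := hd.hasGradientAt.hasFDerivAt
    rw [← AffineMap.lineMap_apply_zero (k := ℝ) x y] at hgrad
    simpa using hgrad.comp_hasDerivAt (0 : ℝ) AffineMap.hasDerivAt_lineMap
  have h := hconv.le_slope_of_hasDerivAt (x := 0) (y := 1) (by simpa using hx) (by simpa using hy)
    one_pos hderiv
  simp only [slope_def_field, Function.comp_apply, AffineMap.lineMap_apply_zero,
    AffineMap.lineMap_apply_one, sub_zero, div_one] at h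
  linarith

/-- A projected gradient step with step size `1 / α` minimizes over `K` the quadratic upper model
of curvature `α`. -/
theorem quadratic_model_le_of_projected_gradient_step {E : Type*} [NormedAddCommGroup E]
    [InnerProductSpace ℝ E] {α : ℝ} (hα : 0 < α) {x x' u g : E}
    (h : ‖x' - (x - (1 / α) • g)‖ ≤ ‖u - (x - (1 / α) • g)‖) :
    ⟪g, x' - x⟫ + α / 2 * ‖x - x'‖ ^ 2 ≤ ⟪g, u - x⟫ + α / 2 * ‖x - u‖ ^ 2 := by
  have expand (v : E) : α / 2 * ‖v - (x - (1 / α) • g)‖ ^ 2 =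
      ⟪g, v - x⟫ + α / 2 * ‖x - v‖ ^ 2 + α / 2 * ‖(1 / α) • g‖ ^ 2 := by
    rw [show v - (x - (1 / α) • g) = (v - x) + (1 / α) • g by abel, norm_add_sq_real,
      inner_smul_right, real_inner_comm, norm_sub_rev x v]
    field_simp
    ring
  have hsq : α / 2 * ‖x' - (x - (1 / α) • g)‖ ^ 2 ≤ α / 2 * ‖u - (x - (1 / α) • g)‖ ^ 2 := by
    gcongr
  rw [expand, expand] at hsq
  linarith

/-- Optimizing the trade-off parameter `l ∈ [0, 1]` in a family of quadratic bounds. -/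
theorem le_add_sqrt_of_forall_mul_le {R A B : ℝ} (hA : 0 ≤ A) (hB : 0 ≤ B)
    (h : ∀ l ∈ Set.Icc (0 : ℝ) 1, l * R ≤ A + l ^ 2 * (B / 2)) :
    R ≤ A + √(2 * A * B) := by
  have hs := Real.sqrt_nonneg (2 * A * B)
  rcases le_or_gt R 0 with hR | hR
  · linarith
  rcases le_or_gt R B with hRB | hRB
  · have hBpos : 0 < B := hR.trans_le hRB
    have hl := h (R / B) ⟨by positivity, (div_le_one hBpos).2 hRB⟩
    have hRsq : R ^ 2 ≤ 2 * A * B := by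
      field_simp at hl
      nlinarith
    linarith [Real.le_sqrt_of_sq_le hRsq]
  · have h1 := h 1 ⟨zero_le_one, le_rfl⟩
    have hBs : B / 2 ≤ √(2 * A * B) := Real.le_sqrt_of_sq_le (by nlinarith)
    linarith

/-- One projected gradient step decreases an `α`-smooth convex function by at least a multiple
of its suboptimality gap, up to a quadratic error. -/
theorem projected_gradient_step_decrease {E : Type*} [NormedAddCommGroup E]
    [InnerProductSpace ℝ E] [CompleteSpace E] {K : Set E} {f : E → ℝ} (hf : ConvexOn ℝ K f)
    {α D : ℝ} (hα : 0 < α) {x x' z : E} (hx : x ∈ K) (hz : z ∈ K) (hd : DifferentiableAt ℝ f x)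
    (hsmooth : f x' ≤ f x + ⟪gradient f x, x' - x⟫ + α / 2 * ‖x - x'‖ ^ 2)
    (hproj : ∀ u ∈ K,
      ‖x' - (x - (1 / α) • gradient f x)‖ ≤ ‖u - (x - (1 / α) • gradient f x)‖)
    (hD : ‖x - z‖ ≤ D) {l : ℝ} (hl : l ∈ Set.Icc (0 : ℝ) 1) :
    l * (f x - f z) ≤ f x - f x' + l ^ 2 * (α * D ^ 2 / 2) := by
  have hmodel := quadratic_model_le_of_projected_gradient_step hα
    (hproj _ (hf.1.add_smul_sub_mem hx hz hl))
  have hnorm : ‖x - (x + l • (z - x))‖ = l * ‖x - z‖ := by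
    rw [sub_add_cancel_left, norm_neg, norm_smul, Real.norm_of_nonneg hl.1, norm_sub_rev]
  rw [add_sub_cancel_left, inner_smul_right, hnorm] at hmodel
  have hgrad : l * ⟪gradient f x, z - x⟫ ≤ l * (f z - f x) :=
    mul_le_mul_of_nonneg_left (by linarith [hf.add_inner_gradient_le hx hz hd]) hl.1
  have hDsq : α / 2 * (l * ‖x - z‖) ^ 2 ≤ α / 2 * (l * D) ^ 2 := by
    have := hl.1
    gcongr
  linarith

/-- Summation by parts: the telescoping of per-round decreases along a sequence, with the error
given by the variation of the functions. -/
theorem sum_decrease_le_add_sum_variation {E : Type*} {f : ℕ → E → ℝ} {x : ℕ → E} {δ : ℕ → ℝ}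
    (n : ℕ) (h : ∀ t ∈ Icc 2 (n + 1), f t (x t) - f (t - 1) (x t) ≤ δ t) :
    ∑ t ∈ Icc 1 n, (f t (x t) - f t (x (t + 1))) ≤
      f 1 (x 1) - f (n + 1) (x (n + 1)) + ∑ t ∈ Icc 2 (n + 1), δ t := by
  induction n with
  | zero => simp
  | succ n ih =>
    rw [sum_Icc_succ_top (by omega), sum_Icc_succ_top (b := n + 1) (by omega)]
    have hlast := h (n + 1 + 1) (by simp)
    have := ih fun t ht => h t (Icc_subset_Icc_right (by omega) ht)
    simp only [add_tsub_cancel_right] at hlast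
    linarith

/-- Theorem 6: dynamic regret of online gradient descent with step
size 1/α for smooth functions. -/
theorem ogd_dynamic_regret_smooth
    {d T : ℕ} (hT : 1 ≤ T) {K : Set (EuclideanSpace ℝ (Fin d))}
    (hKne : K.Nonempty) (hKconv : Convex ℝ K)
    {D : ℝ} (hD : 0 < D) (hdiam : ∀ x ∈ K, ∀ y ∈ K, ‖x - y‖ ≤ D)
    {α : ℝ} (hα : 0 < α)
    {f : ℕ → EuclideanSpace ℝ (Fin d) → ℝ}
    (hfdiff : ∀ t ∈ Finset.Icc 1 T, Differentiable ℝ (f t))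
    (hfconv : ∀ t ∈ Finset.Icc 1 T, ConvexOn ℝ K (f t))
    (hfsmooth : ∀ t ∈ Finset.Icc 1 T, ∀ x ∈ K, ∀ y ∈ K,
      f t y ≤ f t x + ⟪gradient (f t) x, y - x⟫ + α / 2 * ‖x - y‖ ^ 2)
    {xstar : ℕ → EuclideanSpace ℝ (Fin d)}
    (hxstarK : ∀ t ∈ Finset.Icc 1 T, xstar t ∈ K)
    (hxstar : ∀ t ∈ Finset.Icc 1 T, ∀ u ∈ K, f t (xstar t) ≤ f t u)
    {x : ℕ → EuclideanSpace ℝ (Fin d)} (hx1 : x 1 ∈ K)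
    (hxK : ∀ t ∈ Finset.Icc 1 (T - 1), x (t + 1) ∈ K)
    (hproj : ∀ t ∈ Finset.Icc 1 (T - 1), ∀ u ∈ K,
      ‖x (t + 1) - (x t - (1 / α) • gradient (f t) (x t))‖ ≤
        ‖u - (x t - (1 / α) • gradient (f t) (x t))‖)
    {M : ℝ} (hMbound : ∀ t ∈ Finset.Icc 1 T, ∀ u ∈ K, 2 * |f t u| ≤ M)
    {δ : ℕ → ℝ}
    (hδ : ∀ t ∈ Finset.Icc 2 T, ∀ u ∈ K, |f t u - f (t - 1) u| ≤ δ t) :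
    ∑ t ∈ Finset.Icc 1 T, f t (x t) - ∑ t ∈ Finset.Icc 1 T, f t (xstar t) ≤
      M + ∑ t ∈ Finset.Icc 2 T, δ t
        + Real.sqrt (2 * α * D ^ 2 * ((T : ℝ) - 1)
            * (M + ∑ t ∈ Finset.Icc 2 T, δ t)) := by
  obtain ⟨n, rfl⟩ : ∃ n, T = n + 1 := ⟨T - 1, by omega⟩
  simp only [add_tsub_cancel_right] at hxK hproj
  have hxmem : ∀ t ∈ Icc 1 (n + 1), x t ∈ K := by
    intro t ht
    rw [mem_Icc] at ht
    rcases ht.1.eq_or_lt with rfl | h1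
    · exact hx1
    · have := hxK (t - 1) (mem_Icc.2 (by omega))
      rwa [Nat.sub_add_cancel ht.1] at this
  have hfirst : 1 ∈ Icc 1 (n + 1) := by simp
  have hlast : n + 1 ∈ Icc 1 (n + 1) := by simp
  have hM : 0 ≤ M := (by positivity : 0 ≤ 2 * |f 1 (x 1)|).trans (hMbound 1 hfirst _ hx1)
  have hV : 0 ≤ ∑ t ∈ Icc 2 (n + 1), δ t :=
    sum_nonneg fun t ht => (abs_nonneg _).trans (hδ t ht _ hx1)
  have key := le_add_sqrt_of_forall_mul_le
    (R := ∑ t ∈ Icc 1 (n + 1), f t (x t) - ∑ t ∈ Icc 1 (n + 1), f t (xstar t))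
    (A := M + ∑ t ∈ Icc 2 (n + 1), δ t) (B := n * (α * D ^ 2)) (by positivity) (by positivity) ?_
  · convert key using 3
    push_cast
    ring
  intro l hl
  have hstep : ∑ t ∈ Icc 1 n, l * (f t (x t) - f t (xstar t)) ≤
      ∑ t ∈ Icc 1 n, (f t (x t) - f t (x (t + 1)) + l ^ 2 * (α * D ^ 2 / 2)) := by
    refine sum_le_sum fun t ht => ?_
    have ht' : t ∈ Icc 1 (n + 1) := Icc_subset_Icc_right n.le_succ ht
    exact projected_gradient_step_decrease (hfconv t ht') hα (hxmem t ht') (hxstarK t ht')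
      (hfdiff t ht' _) (hfsmooth t ht' _ (hxmem t ht') _ (hxK t ht)) (hproj t ht)
      (hdiam _ (hxmem t ht') _ (hxstarK t ht')) hl
  have htel := sum_decrease_le_add_sum_variation (f := f) (x := x) (δ := δ) n fun t ht =>
    (le_abs_self _).trans (hδ t ht _ (hxmem t (Icc_subset_Icc_left one_le_two ht)))
  rw [sum_add_distrib, ← mul_sum, sum_const, Nat.card_Icc, add_tsub_cancel_right,
    nsmul_eq_mul] at hstep
  rw [← sum_sub_distrib, sum_Icc_succ_top (by omega), mul_add]
  have habs_first := (le_abs_self _).trans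
    ((le_div_iff₀' two_pos).2 (hMbound 1 hfirst _ hx1))
  have habs_last := (neg_le_abs _).trans
    ((le_div_iff₀' two_pos).2 (hMbound (n + 1) hlast _ (hxmem _ hlast)))
  have habs_star := (neg_le_abs _).trans
    ((le_div_iff₀' two_pos).2 (hMbound (n + 1) hlast _ (hxstarK _ hlast)))
  have hmix : -((1 - l) * f (n + 1) (x (n + 1))) - l * f (n + 1) (xstar (n + 1)) ≤ M / 2 := by
    have h1 := mul_le_mul_of_nonneg_left habs_last (sub_nonneg.2 hl.2)
    have h2 := mul_le_mul_of_nonneg_left habs_star hl.1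
    linarith
  linarith
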